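/- Fix an integer k ≥ 3. If r = r(n) satisfies r(n)/(k · C(n,k)^{1/(k-2)}) → ∞, then the probability that a uniformly random r(n)-coloring of the edges of K_n contains a monochromatic spanning tree on some k vertices (a monochromatic k-tree) tends to 0; if r(n) ≤ (k/n) · C(n,k)^{1/(k-2)}, this probability tends to 1. -/

import Mathlib

open Finset Filter

open scoped Classical

noncomputable section

/-- A finset of edges of `K_n` forms a matching: all edges are proper (non-loop)
and no two distinct edges share a vertex. -/
def IsMatching {n : ℕ} (M : Finset (Sym2 (Fin n))) : Prop :=
  (∀ e ∈ M, ¬ e.IsDiag) ∧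
    ∀ e ∈ M, ∀ f ∈ M, e ≠ f → ∀ v : Fin n, v ∈ e → v ∉ f

/-- The finset of all `k`-matchings of `K_n`. -/
def matchings (n k : ℕ) : Finset (Finset (Sym2 (Fin n))) :=
  Finset.univ.filter fun M => M.card = k ∧ IsMatching M

/-- All edges in `M` receive the same color under the coloring `c`. -/
def Monochromatic {n r : ℕ} (c : Sym2 (Fin n) → Fin r)
    (M : Finset (Sym2 (Fin n))) : Prop :=
  ∃ col, ∀ e ∈ M, c e = col

/-- Distinct edges in `M` receive pairwise distinct colors under `c`. -/
def Heterochromatic {n r : ℕ} (c : Sym2 (Fin n) → Fin r)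
    (M : Finset (Sym2 (Fin n))) : Prop :=
  ∀ e ∈ M, ∀ f ∈ M, e ≠ f → c e ≠ c f

/-- Probability of an event `P` under a uniformly random `r`-coloring of the
edges of `K_n`. -/
def Pr (n r : ℕ) (P : (Sym2 (Fin n) → Fin r) → Prop) : ℚ :=
  ((Finset.univ.filter P).card : ℚ) / (Fintype.card (Sym2 (Fin n) → Fin r) : ℚ)

/-- Expected number of monochromatic `k`-matchings in a uniformly random
`r`-coloring of the edges of `K_n`. -/
def EXmono (n r k : ℕ) : ℚ :=
  (∑ c : Sym2 (Fin n) → Fin r,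
      (((matchings n k).filter fun M => Monochromatic c M).card : ℚ)) /
    (Fintype.card (Sym2 (Fin n) → Fin r) : ℚ)

/-- Expected number of heterochromatic `k`-matchings in a uniformly random
`r`-coloring of the edges of `K_n`. -/
def EYhet (n r k : ℕ) : ℚ :=
  (∑ c : Sym2 (Fin n) → Fin r,
      (((matchings n k).filter fun M => Heterochromatic c M).card : ℚ)) /
    (Fintype.card (Sym2 (Fin n) → Fin r) : ℚ)

/-- The vertex set `S` spans a monochromatic clique: all edges between distinct
vertices of `S` have one common color. -/
def MonoClique {n r : ℕ} (c : Sym2 (Fin n) → Fin r) (S : Finset (Fin n)) : Prop :=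
  ∃ col, ∀ u ∈ S, ∀ v ∈ S, u ≠ v → c s(u, v) = col

/-- The vertex set `S` spans a heterochromatic clique: distinct edges between
vertices of `S` have pairwise distinct colors. -/
def HeteroClique {n r : ℕ} (c : Sym2 (Fin n) → Fin r) (S : Finset (Fin n)) : Prop :=
  ∀ u ∈ S, ∀ v ∈ S, ∀ w ∈ S, ∀ x ∈ S,
    u ≠ v → w ≠ x → s(u, v) ≠ s(w, x) → c s(u, v) ≠ c s(w, x)

/-- `T` is the edge set of a tree with vertex set `S`: it consists of
`S.card - 1` proper edges inside `S` and connects all vertices of `S`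
(a connected graph on `|S|` vertices with `|S| - 1` edges is a tree). -/
def IsTreeOn {n : ℕ} (S : Finset (Fin n)) (T : Finset (Sym2 (Fin n))) : Prop :=
  T.card + 1 = S.card ∧ (∀ e ∈ T, ¬ e.IsDiag) ∧
    (∀ e ∈ T, ∀ v : Fin n, v ∈ e → v ∈ S) ∧
    ∀ u ∈ S, ∀ v ∈ S,
      (SimpleGraph.fromEdgeSet (↑T : Set (Sym2 (Fin n)))).Reachable u v

lemma Pr_real (n r : ℕ) (P : (Sym2 (Fin n) → Fin r) → Prop) [DecidablePred P] :
    ((Pr n r P : ℚ) : ℝ) =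
      ((univ.filter P).card : ℝ) / (r : ℝ) ^ Fintype.card (Sym2 (Fin n)) := by
  unfold Pr
  rw [Fintype.card_fun, Fintype.card_fin]
  push_cast
  congr!

lemma card_good {α : Type*} [Fintype α] [DecidableEq α] (r : ℕ) (D : Finset α) (ρ : α → α)
    (h : ∀ e ∈ D, ρ e ∉ D) :
    (univ.filter fun c : α → Fin r => ∀ e ∈ D, c e = c (ρ e)).card * r ^ D.card
      = r ^ Fintype.card α := by
  let f : {c : α → Fin r // ∀ e ∈ D, c e = c (ρ e)} ≃ ({x // x ∉ D} → Fin r) :=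
    { toFun := fun c x => c.1 x.1
      invFun := fun g => ⟨fun e => if he : e ∈ D then g ⟨ρ e, h e he⟩ else g ⟨e, he⟩, by
        intro e he
        simp [he, h e he]⟩
      left_inv := by
        rintro ⟨c, hc⟩
        ext e
        by_cases he : e ∈ D
        · simp [he, hc e he]
        · simp [he]
      right_inv := by
        intro g
        ext ⟨e, he⟩
        simp [he] }
  have h1 := Fintype.card_congr f
  rw [Fintype.card_subtype] at h1
  have h2 : Fintype.card {x // x ∉ D} + D.card = Fintype.card α := by
    have := Fintype.card_subtype_compl (fun x => x ∈ D)
    rw [this]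
    simp only [Fintype.card_coe]
    exact Nat.sub_add_cancel (Finset.card_le_univ D)
  rw [h1, Fintype.card_fun, Fintype.card_fin, ← pow_add, h2]

lemma mono_iff {n r : ℕ} (c : Sym2 (Fin n) → Fin r) (T : Finset (Sym2 (Fin n)))
    (e0) (h0 : e0 ∈ T) : Monochromatic c T ↔ ∀ e ∈ T, c e = c e0 := by
  constructor
  · rintro ⟨col, h⟩ e he
    rw [h e he, h e0 h0]
  · intro h
    exact ⟨_, h⟩

lemma mono_card {n : ℕ} (r s : ℕ) (T : Finset (Sym2 (Fin n))) (hT : T.card = s + 1) :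
    (univ.filter fun c : Sym2 (Fin n) → Fin r => Monochromatic c T).card * r ^ s
      = r ^ Fintype.card (Sym2 (Fin n)) := by
  obtain ⟨e0, h0⟩ : T.Nonempty := by
    rw [← Finset.card_pos]; omega
  have := card_good r (T.erase e0) (fun _ => e0) (by simp)
  rw [Finset.card_erase_of_mem h0, hT, Nat.add_sub_cancel] at this
  rw [← this]
  congr 2
  ext c
  simp only [mem_filter, mem_univ, true_and]
  rw [mono_iff c T e0 h0]
  constructor
  · intro h e he
    exact h e (mem_of_mem_erase he)
  · intro h e he
    by_cases hh : e = e0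
    · rw [hh]
    · exact h e (mem_erase.2 ⟨hh, he⟩)

lemma mono_pair {n : ℕ} (r s : ℕ) (T U : Finset (Sym2 (Fin n))) (hT : T.card = s + 1)
    (hU : U.card = s + 1) (hTU : (T ∩ U).card ≤ 1) :
    (univ.filter fun c : Sym2 (Fin n) → Fin r => Monochromatic c T ∧ Monochromatic c U).card
      * r ^ (s + s) = r ^ Fintype.card (Sym2 (Fin n)) := by
  obtain ⟨a, b, ha, hb, hab⟩ : ∃ a b, a ∈ T ∧ b ∈ U ∧
      ∀ e, e ∈ T → e ∈ U → e = a ∧ e = b := by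
    by_cases hne : (T ∩ U).Nonempty
    · obtain ⟨x, hx⟩ := hne
      have hx' := mem_inter.1 hx
      refine ⟨x, x, hx'.1, hx'.2, fun e h1 h2 => ?_⟩
      have := Finset.card_le_one.1 hTU e (mem_inter.2 ⟨h1, h2⟩) x hx
      exact ⟨this, this⟩
    · obtain ⟨a, ha⟩ : T.Nonempty := by rw [← Finset.card_pos]; omega
      obtain ⟨b, hb⟩ : U.Nonempty := by rw [← Finset.card_pos]; omega
      exact ⟨a, b, ha, hb, fun e h1 h2 => absurd ⟨e, mem_inter.2 ⟨h1, h2⟩⟩ hne⟩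
  have := card_good r (T.erase a ∪ U.erase b) (fun e => if e ∈ T then a else b) (by
    intro e he
    by_cases hT' : e ∈ T
    · simp only [hT', if_true, mem_union, mem_erase, not_or]
      refine ⟨by simp, ?_⟩
      rintro ⟨h1, h2⟩
      exact h1 (hab a ha h2).2
    · simp only [hT', if_false, mem_union, mem_erase, not_or]
      refine ⟨?_, by simp⟩
      rintro ⟨h1, h2⟩
      exact h1 (hab b h2 hb).1)
  have hd : Disjoint (T.erase a) (U.erase b) := by
    rw [Finset.disjoint_left]
    intro e h1 h2
    exact (mem_erase.1 h1).1 (hab e (mem_erase.1 h1).2 (mem_erase.1 h2).2).1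
  rw [Finset.card_union_of_disjoint hd, Finset.card_erase_of_mem ha,
    Finset.card_erase_of_mem hb, hT, hU, Nat.add_sub_cancel] at this
  rw [← this]
  congr 2
  ext c
  simp only [mem_filter, mem_univ, true_and]
  rw [mono_iff c T a ha, mono_iff c U b hb]
  constructor
  · rintro ⟨h1, h2⟩ e he
    by_cases hT' : e ∈ T
    · simp [hT', h1 e hT']
    · simp only [hT', if_false]
      rcases mem_union.1 he with h | h
      · exact absurd (mem_of_mem_erase h) hT'
      · exact h2 e (mem_of_mem_erase h)
  · intro h
    constructor
    · intro e he
      by_cases hh : e = a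
      · rw [hh]
      · have := h e (mem_union_left _ (mem_erase.2 ⟨hh, he⟩))
        simpa [he] using this
    · intro e he
      by_cases hh : e = b
      · rw [hh]
      · have := h e (mem_union_right _ (mem_erase.2 ⟨hh, he⟩))
        have hT' : e ∉ T := fun h' => hh (hab e h' he).2
        simpa [hT'] using this

lemma second_moment {n r s : ℕ} (hr : 1 ≤ r) {ι : Type} [Fintype ι]
    (E : ι → Finset (Sym2 (Fin n))) (hE : ∀ i, (E i).card = s + 1)
    (hEE : ∀ i j, i ≠ j → (E i ∩ E j).card ≤ 1) :
    ((univ.filter fun c : Sym2 (Fin n) → Fin r => ∀ i, ¬ Monochromatic c (E i)).card : ℝ)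
      * Fintype.card ι ≤ (r : ℝ) ^ Fintype.card (Sym2 (Fin n)) * (r : ℝ) ^ s := by
  rcases Nat.eq_zero_or_pos (Fintype.card ι) with h0 | hM
  · rw [h0]; simp; positivity
  have hM' : (0 : ℝ) < Fintype.card ι := by exact_mod_cast hM
  have hr' : (0 : ℝ) < r := by exact_mod_cast hr
  set M : ℝ := (Fintype.card ι : ℝ) with hMdef
  set N : ℝ := (r : ℝ) ^ Fintype.card (Sym2 (Fin n)) with hN
  set Q : ℝ := (r : ℝ) ^ s with hQ
  have hQ0 : 0 < Q := by positivity
  have hN0 : 0 < N := by positivity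
  let I : ι → (Sym2 (Fin n) → Fin r) → ℝ := fun i c => if Monochromatic c (E i) then 1 else 0
  have h1 : ∀ i, ∑ c, I i c = N / Q := by
    intro i
    rw [eq_div_iff hQ0.ne']
    have := mono_card r s (E i) (hE i)
    simp only [I, Finset.sum_boole]
    rw [hQ, hN]
    exact_mod_cast this
  have h2 : ∀ i j, ∑ c, I i c * I j c ≤ N / Q ^ 2 + if i = j then N / Q else 0 := by
    intro i j
    by_cases hij : i = j
    · subst hij
      simp only [if_true]
      have : ∑ c, I i c * I i c = ∑ c, I i c := by
        apply Finset.sum_congr rfl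
        intro c _
        simp only [I]; split_ifs <;> simp
      rw [this, h1]
      have : 0 < N / Q ^ 2 := by positivity
      linarith
    · simp only [hij, if_false, add_zero]
      apply le_of_eq
      rw [eq_div_iff (by positivity)]
      have := mono_pair r s (E i) (E j) (hE i) (hE j) (hEE i j hij)
      have h3 : ∑ c, I i c * I j c =
          ∑ c : Sym2 (Fin n) → Fin r, if (Monochromatic c (E i) ∧ Monochromatic c (E j)) then (1 : ℝ) else 0 := by
        apply Finset.sum_congr rfl
        intro c _
        simp only [I]
        by_cases ha : Monochromatic c (E i) <;> by_cases hb : Monochromatic c (E j) <;>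
          simp [ha, hb]
      rw [h3, Finset.sum_boole, hQ, hN, ← pow_mul, mul_two]
      exact_mod_cast this
  have hNc : ((univ : Finset (Sym2 (Fin n) → Fin r)).card : ℝ) = N := by
    rw [Finset.card_univ, Fintype.card_fun, Fintype.card_fin, hN]; push_cast; rfl
  have h3 : ∑ c, (∑ i, I i c - M / Q) ^ 2 ≤ M * N / Q := by
    have e1 : ∑ c, (∑ i, I i c - M / Q) ^ 2
        = ∑ i, ∑ j, ∑ c, I i c * I j c - 2 * (M / Q) * ∑ i, ∑ c, I i c + N * (M / Q) ^ 2 := by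
      have : ∀ c, (∑ i, I i c - M / Q) ^ 2
        = ∑ i, ∑ j, I i c * I j c - 2 * (M / Q) * ∑ i, I i c + (M / Q) ^ 2 := by
        intro c
        rw [← Finset.sum_mul_sum]; ring
      simp_rw [this]
      rw [Finset.sum_add_distrib, Finset.sum_sub_distrib, Finset.sum_const, nsmul_eq_mul, hNc,
        ← Finset.mul_sum]
      congr 2
      · rw [Finset.sum_comm]
        apply Finset.sum_congr rfl
        intro i _
        rw [Finset.sum_comm]
      · rw [Finset.sum_comm]
    have e2 : ∑ i, ∑ j, ∑ c, I i c * I j c ≤ M * (M * (N / Q ^ 2) + N / Q) := by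
      calc ∑ i, ∑ j, ∑ c, I i c * I j c
          ≤ ∑ i, ∑ j, (N / Q ^ 2 + if i = j then N / Q else 0) :=
            Finset.sum_le_sum fun i _ => Finset.sum_le_sum fun j _ => h2 i j
        _ = _ := by
            simp [Finset.sum_add_distrib, hMdef]
            ring
    have e3 : ∑ i, ∑ c, I i c = M * (N / Q) := by
      simp_rw [h1]
      simp [hMdef]
    rw [e1, e3]
    have : M * (M * (N / Q ^ 2) + N / Q) - 2 * (M / Q) * (M * (N / Q)) + N * (M / Q) ^ 2
      = M * N / Q := by field_simp; ring
    linarith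
  have h4 : ((univ.filter fun c : Sym2 (Fin n) → Fin r => ∀ i, ¬ Monochromatic c (E i)).card : ℝ)
      * (M / Q) ^ 2 ≤ ∑ c, (∑ i, I i c - M / Q) ^ 2 := by
    rw [← nsmul_eq_mul, ← Finset.sum_const]
    calc _ = ∑ c ∈ univ.filter (fun c : Sym2 (Fin n) → Fin r => ∀ i, ¬ Monochromatic c (E i)),
          (∑ i, I i c - M / Q) ^ 2 := by
          apply Finset.sum_congr rfl
          intro c hc
          have hc' := (mem_filter.1 hc).2
          have : ∑ i, I i c = 0 := Finset.sum_eq_zero fun i _ => by simp [I, hc' i]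
          rw [this]; ring
      _ ≤ _ := Finset.sum_le_sum_of_subset_of_nonneg (Finset.filter_subset _ _)
          fun _ _ _ => sq_nonneg _
  have h5 := h4.trans h3
  set X := ((univ.filter fun c : Sym2 (Fin n) → Fin r =>
    ∀ i, ¬ Monochromatic c (E i)).card : ℝ)
  have h6 : X * (M / Q) ^ 2 = (X * M) * (M / Q ^ 2) := by field_simp
  have h7 : M * N / Q = (N * Q) * (M / Q ^ 2) := by field_simp
  rw [h6, h7] at h5
  exact le_of_mul_le_mul_right h5 (by positivity)

/-- Union bound. -/
lemma upper_bound (n r s : ℕ) (hr : 1 ≤ r) :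
    ((Pr n r (fun c => ∃ S : Finset (Fin n), ∃ T,
        S.card = s + 2 ∧ IsTreeOn S T ∧ Monochromatic c T) : ℚ) : ℝ) * (r : ℝ) ^ s
      ≤ 2 ^ ((s + 3).choose 2) * (n.choose (s + 2) : ℝ) := by
  have hr' : (0 : ℝ) < r := by exact_mod_cast hr
  let F : Finset (Σ _ : Finset (Fin n), Finset (Sym2 (Fin n))) :=
    (univ.powersetCard (s + 2)).sigma
      (fun S => S.sym2.powerset.filter (fun T => T.card = s + 1))
  have hsub : (univ.filter (fun c : Sym2 (Fin n) → Fin r => ∃ S : Finset (Fin n), ∃ T,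
        S.card = s + 2 ∧ IsTreeOn S T ∧ Monochromatic c T)) ⊆
      F.biUnion (fun x => univ.filter fun c => Monochromatic c x.2) := by
    intro c hc
    obtain ⟨S, T, hS, hT, hm⟩ := (mem_filter.1 hc).2
    rw [mem_biUnion]
    refine ⟨⟨S, T⟩, ?_, by simpa using hm⟩
    simp only [F, mem_sigma, mem_powersetCard, mem_filter, mem_powerset]
    refine ⟨⟨subset_univ _, hS⟩, ?_, ?_⟩
    · intro e he
      rw [Finset.mem_sym2_iff]
      exact fun v hv => hT.2.2.1 e he v hv
    · have := hT.1
      omega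
  have hF : F.card ≤ n.choose (s + 2) * 2 ^ ((s + 3).choose 2) := by
    rw [Finset.card_sigma]
    calc _ ≤ ∑ S ∈ (univ : Finset (Fin n)).powersetCard (s + 2), 2 ^ ((s + 3).choose 2) := by
          apply Finset.sum_le_sum
          intro S hS
          refine (Finset.card_filter_le _ _).trans ?_
          rw [Finset.card_powerset, Finset.card_sym2, (mem_powersetCard.1 hS).2]
      _ = _ := by simp [Finset.card_powersetCard]
  have h1 : (univ.filter (fun c : Sym2 (Fin n) → Fin r => ∃ S : Finset (Fin n), ∃ T,
        S.card = s + 2 ∧ IsTreeOn S T ∧ Monochromatic c T)).card * r ^ s ≤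
      n.choose (s + 2) * 2 ^ ((s + 3).choose 2) * r ^ Fintype.card (Sym2 (Fin n)) := by
    calc _ ≤ (∑ x ∈ F, (univ.filter fun c : Sym2 (Fin n) → Fin r =>
              Monochromatic c x.2).card) * r ^ s :=
          Nat.mul_le_mul_right _ ((Finset.card_le_card hsub).trans Finset.card_biUnion_le)
      _ = ∑ x ∈ F, r ^ Fintype.card (Sym2 (Fin n)) := by
          rw [Finset.sum_mul]
          apply Finset.sum_congr rfl
          intro x hx
          simp only [F, mem_sigma, mem_filter] at hx
          exact mono_card r s x.2 hx.2.2
      _ ≤ _ := by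
          rw [Finset.sum_const, smul_eq_mul]
          exact Nat.mul_le_mul_right _ hF
  rw [Pr_real, div_mul_eq_mul_div, div_le_iff₀ (by positivity)]
  rw [mul_comm (2 ^ _ : ℝ)]
  have h1' : ((univ.filter (fun c : Sym2 (Fin n) → Fin r => ∃ S : Finset (Fin n), ∃ T,
        S.card = s + 2 ∧ IsTreeOn S T ∧ Monochromatic c T)).card : ℝ) * (r : ℝ) ^ s ≤
      (n.choose (s + 2) : ℝ) * 2 ^ ((s + 3).choose 2) * (r : ℝ) ^ Fintype.card (Sym2 (Fin n)) := by
    exact_mod_cast h1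
  exact h1'

lemma star_tree {n s : ℕ} (v : Fin n) (f : Fin (s + 1) → Fin n) (hf : Function.Injective f)
    (hv : ∀ t, f t ≠ v) :
    (univ.image fun t => s(v, f t)).card = s + 1 ∧
    (insert v (univ.image f)).card = s + 2 ∧
    IsTreeOn (insert v (univ.image f)) (univ.image fun t => s(v, f t)) := by
  have c1 : (univ.image fun t => s(v, f t)).card = s + 1 := by
    rw [Finset.card_image_of_injective]
    · simp
    · intro a b hab
      exact hf (Sym2.congr_right.1 hab)
  have c2 : (insert v (univ.image f)).card = s + 2 := by
    rw [Finset.card_insert_of_notMem, Finset.card_image_of_injective _ hf]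
    · simp
    · simp [hv]
  refine ⟨c1, c2, by rw [c1, c2], ?_, ?_, ?_⟩
  · intro e he
    obtain ⟨t, -, rfl⟩ := mem_image.1 he
    simpa using (hv t).symm
  · intro e he w hw
    obtain ⟨t, -, rfl⟩ := mem_image.1 he
    rcases Sym2.mem_iff.1 hw with rfl | rfl
    · simp
    · simp
  · have key : ∀ u ∈ insert v (univ.image f), (SimpleGraph.fromEdgeSet
        (↑(univ.image fun t => s(v, f t)) : Set (Sym2 (Fin n)))).Reachable v u := by
      intro u hu
      rcases mem_insert.1 hu with rfl | hu
      · exact SimpleGraph.Reachable.refl _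
      · obtain ⟨t, -, rfl⟩ := mem_image.1 hu
        apply SimpleGraph.Adj.reachable
        rw [SimpleGraph.fromEdgeSet_adj]
        exact ⟨mem_coe.2 (mem_image_of_mem _ (mem_univ t)), (hv t).symm⟩
    intro u hu w hw
    exact (key u hu).symm.trans (key w hw)

lemma lower_bound (n r s p : ℕ) (hr : 1 ≤ r) (hp : p.Prime) (hsp : s + 1 ≤ p)
    (hn : p * (s + 2) ≤ n) :
    1 - (r : ℝ) ^ s / (p : ℝ) ^ 3 ≤
    ((Pr n r (fun c => ∃ S : Finset (Fin n), ∃ T,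
        S.card = s + 2 ∧ IsTreeOn S T ∧ Monochromatic c T) : ℚ) : ℝ) := by
  have hr' : (0 : ℝ) < r := by exact_mod_cast hr
  have hp' : (0 : ℝ) < p := by exact_mod_cast hp.pos
  have : Fact p.Prime := ⟨hp⟩
  obtain ⟨φ⟩ : Nonempty (ZMod p × Option (Fin (s + 1)) ↪ Fin n) := by
    apply Function.Embedding.nonempty_of_card_le
    simpa [ZMod.card] using hn
  let ctr : ZMod p → Fin n := fun d => φ (d, none)
  let lf : ZMod p → ZMod p → Fin (s + 1) → Fin n :=
    fun i j t => φ (i + (t.val : ZMod p) * j, some t)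
  let E : ZMod p × ZMod p × ZMod p → Finset (Sym2 (Fin n)) :=
    fun x => univ.image fun t => s(ctr x.1, lf x.2.1 x.2.2 t)
  have hst := fun x : ZMod p × ZMod p × ZMod p =>
    star_tree (ctr x.1) (lf x.2.1 x.2.2)
      (by intro a b hab; have := φ.injective hab; simp at this; exact this.2)
      (by intro t h; have := φ.injective h; simp at this)
  have hedge : ∀ d d' i i' j j' t t', s(ctr d, lf i j t) = s(ctr d', lf i' j' t') →
      d = d' ∧ t = t' ∧ i + (t.val : ZMod p) * j = i' + (t.val : ZMod p) * j' := by
    intro d d' i i' j j' t t' h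
    rcases Sym2.eq_iff.1 h with ⟨h1, h2⟩ | ⟨h1, h2⟩
    · have h1 := φ.injective h1
      have h2 := φ.injective h2
      simp only [Prod.mk.injEq, Option.some.injEq, and_true] at h1 h2
      obtain ⟨h2, rfl⟩ := h2
      exact ⟨h1, rfl, h2⟩
    · have h1 := φ.injective h1
      simp at h1
  have hEE : ∀ x y, x ≠ y → (E x ∩ E y).card ≤ 1 := by
    rintro ⟨d, i, j⟩ ⟨d', i', j'⟩ hxy
    rw [Finset.card_le_one]
    intro a ha b hb
    rw [mem_inter] at ha hb
    obtain ⟨t, -, rfl⟩ := mem_image.1 ha.1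
    obtain ⟨t', -, ht'⟩ := mem_image.1 ha.2
    obtain ⟨u, -, rfl⟩ := mem_image.1 hb.1
    obtain ⟨u', -, hu'⟩ := mem_image.1 hb.2
    obtain ⟨hd, -, h1⟩ := hedge _ _ _ _ _ _ _ _ ht'.symm
    obtain ⟨-, -, h2⟩ := hedge _ _ _ _ _ _ _ _ hu'.symm
    by_cases htu : t = u
    · rw [htu]
    exfalso
    apply hxy
    simp only at hd h1 h2
    have h3 : ((t.val : ZMod p) - (u.val : ZMod p)) * (j - j') = 0 := by
      linear_combination h1 - h2
    have h4 : (t.val : ZMod p) - (u.val : ZMod p) ≠ 0 := by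
      rw [sub_ne_zero]
      intro h
      apply htu
      rw [ZMod.natCast_eq_natCast_iff'] at h
      rw [Nat.mod_eq_of_lt (by omega), Nat.mod_eq_of_lt (by omega)] at h
      exact Fin.ext h
    have hj : j = j' := by
      rcases mul_eq_zero.1 h3 with h | h
      · exact absurd h h4
      · exact sub_eq_zero.1 h
    subst hj hd
    have hi : i = i' := by linear_combination h1
    rw [hi]
  have hsm := second_moment hr E (fun x => (hst x).1) hEE
  have hcard : (Fintype.card (ZMod p × ZMod p × ZMod p) : ℝ) = (p : ℝ) ^ 3 := by
    simp [ZMod.card]; ring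
  rw [hcard] at hsm
  set P : (Sym2 (Fin n) → Fin r) → Prop := fun c => ∃ S : Finset (Fin n), ∃ T,
        S.card = s + 2 ∧ IsTreeOn S T ∧ Monochromatic c T with hP
  have hcompl : (univ.filter fun c => ¬ P c).card ≤
      (univ.filter fun c : Sym2 (Fin n) → Fin r => ∀ i, ¬ Monochromatic c (E i)).card := by
    apply Finset.card_le_card
    intro c hc
    simp only [mem_filter, mem_univ, true_and] at hc ⊢
    intro x hx
    exact hc ⟨_, _, (hst x).2.1, (hst x).2.2, hx⟩
  have hsum := Finset.card_filter_add_card_filter_not (s := (univ : Finset (Sym2 (Fin n) → Fin r))) P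
  rw [Finset.card_univ, Fintype.card_fun, Fintype.card_fin] at hsum
  have hsum' : ((univ.filter P).card : ℝ) + ((univ.filter fun c => ¬ P c).card : ℝ)
     = (r : ℝ) ^ Fintype.card (Sym2 (Fin n)) := by exact_mod_cast hsum
  have hcompl' : ((univ.filter fun c => ¬ P c).card : ℝ) ≤
      ((univ.filter fun c : Sym2 (Fin n) → Fin r => ∀ i, ¬ Monochromatic c (E i)).card : ℝ) := by
    exact_mod_cast hcompl
  rw [Pr_real, le_div_iff₀ (by positivity)]
  rw [← le_div_iff₀ (by positivity)] at hsm
  have : (r : ℝ) ^ Fintype.card (Sym2 (Fin n)) * (r : ℝ) ^ s / (p : ℝ) ^ 3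
    = (r : ℝ) ^ s / (p : ℝ) ^ 3 * (r : ℝ) ^ Fintype.card (Sym2 (Fin n)) := by ring
  have hfin : (1 - (r : ℝ) ^ s / (p : ℝ) ^ 3) * (r : ℝ) ^ Fintype.card (Sym2 (Fin n)) ≤
      ((univ.filter P).card : ℝ) := by
    have h9 := hcompl'.trans hsm
    rw [this] at h9
    linarith
  exact hfin

lemma Pr_nonneg (n r : ℕ) (P) : 0 ≤ ((Pr n r P : ℚ) : ℝ) := by
  have : 0 ≤ Pr n r P := by unfold Pr; positivity
  exact_mod_cast this

lemma Pr_le_one (n r : ℕ) (P) : ((Pr n r P : ℚ) : ℝ) ≤ 1 := by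
  have : Pr n r P ≤ 1 := by
    unfold Pr
    apply div_le_one_of_le₀
    · exact_mod_cast Finset.card_le_univ _
    · positivity
  exact_mod_cast this

/-- for fixed `k ≥ 3`: if `r(n)/(k · C(n,k)^(1/(k-2))) → ∞`,
the probability of containing a monochromatic `k`-tree tends to `0`; if
`r(n) ≤ (k/n) · C(n,k)^(1/(k-2))`, it tends to `1`. -/
theorem mono_tree_threshold (k : ℕ) (hk : 3 ≤ k) (r : ℕ → ℕ) :
    (Tendsto
        (fun n => (r n : ℝ) /
          ((k : ℝ) * (n.choose k : ℝ) ^ ((1 : ℝ) / ((k : ℝ) - 2))))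
        atTop atTop →
      Tendsto
        (fun n =>
          ((Pr n (r n)
              (fun c => ∃ S : Finset (Fin n), ∃ T,
                S.card = k ∧ IsTreeOn S T ∧ Monochromatic c T) : ℚ) : ℝ))
        atTop (nhds 0)) ∧
    ((∀ᶠ n in atTop,
        1 ≤ r n ∧
          (r n : ℝ) ≤
            (k : ℝ) / (n : ℝ) * (n.choose k : ℝ) ^ ((1 : ℝ) / ((k : ℝ) - 2))) →
      Tendsto
        (fun n =>
          ((Pr n (r n)
              (fun c => ∃ S : Finset (Fin n), ∃ T,
                S.card = k ∧ IsTreeOn S T ∧ Monochromatic c T) : ℚ) : ℝ))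
        atTop (nhds 1)) := by
  obtain ⟨s, rfl⟩ : ∃ s, k = s + 2 := ⟨k - 2, by omega⟩
  have hs : s ≠ 0 := by omega
  have hexp : (1 : ℝ) / (((s + 2 : ℕ) : ℝ) - 2) = ((s : ℝ))⁻¹ := by
    push_cast; rw [one_div]; congr 1; ring
  simp only [hexp]
  have hroot : ∀ n : ℕ, ((n.choose (s + 2) : ℝ) ^ ((s : ℝ))⁻¹) ^ s = (n.choose (s + 2) : ℝ) :=
    fun n => Real.rpow_inv_natCast_pow (by positivity) hs
  have hroot0 : ∀ n : ℕ, 0 ≤ ((n.choose (s + 2) : ℝ) ^ ((s : ℝ))⁻¹) := fun n => by positivity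
  constructor
  · intro h
    have hlim : Tendsto (fun n => (2 : ℝ) ^ ((s + 3).choose 2) / ((r n : ℝ) /
        (((s + 2 : ℕ) : ℝ) * (n.choose (s + 2) : ℝ) ^ ((s : ℝ))⁻¹))) atTop (nhds 0) :=
      h.const_div_atTop _
    refine squeeze_zero' (Eventually.of_forall fun n => Pr_nonneg _ _ _) ?_ hlim
    filter_upwards [h.eventually_ge_atTop 1, eventually_ge_atTop (s + 2)] with n hx hn
    have hC : (0 : ℝ) < n.choose (s + 2) := by exact_mod_cast Nat.choose_pos hn
    have hy := hroot n
    have hy0 := hroot0 n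
    set y := (n.choose (s + 2) : ℝ) ^ ((s : ℝ))⁻¹ with hydef
    have hypos : 0 < y := by rw [hydef]; positivity
    have hk0 : (1 : ℝ) ≤ ((s + 2 : ℕ) : ℝ) := by push_cast; linarith [(Nat.cast_nonneg s : (0 : ℝ) ≤ s)]
    set x := (r n : ℝ) / (((s + 2 : ℕ) : ℝ) * y) with hxdef
    have hrx : (r n : ℝ) = x * ((s + 2 : ℕ) : ℝ) * y := by
      rw [hxdef]; field_simp
    have hr : 1 ≤ r n := by
      rw [Nat.one_le_iff_ne_zero]
      intro h0
      rw [h0] at hxdef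
      simp at hxdef
      linarith
    have hub := upper_bound n (r n) s hr
    have hrs : x * (n.choose (s + 2) : ℝ) ≤ (r n : ℝ) ^ s := by
      rw [hrx, mul_pow, mul_pow, hy]
      have h1 : x ≤ x ^ s := le_self_pow₀ hx hs
      have h2 : (1 : ℝ) ≤ ((s + 2 : ℕ) : ℝ) ^ s := one_le_pow₀ hk0
      have h3 : x ≤ x ^ s * ((s + 2 : ℕ) : ℝ) ^ s := by nlinarith
      exact mul_le_mul_of_nonneg_right h3 hC.le
    rw [le_div_iff₀ (by linarith)]
    have h4 := (mul_le_mul_of_nonneg_left hrs (Pr_nonneg n (r n) _)).trans hub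
    rw [← mul_assoc] at h4
    exact le_of_mul_le_mul_right h4 hC
  · intro h
    have hlim : Tendsto (fun n : ℕ => 1 - (((s + 2 : ℕ) : ℝ) ^ s * (2 * ((s + 2 : ℕ) : ℝ)) ^ 3)
        / (n : ℝ)) atTop (nhds 1) := by
      have := (tendsto_const_div_atTop_nhds_zero_nat
        (((s + 2 : ℕ) : ℝ) ^ s * (2 * ((s + 2 : ℕ) : ℝ)) ^ 3)).const_sub 1
      simpa using this
    refine tendsto_of_tendsto_of_tendsto_of_le_of_le' hlim tendsto_const_nhds ?_
      (Eventually.of_forall fun n => Pr_le_one _ _ _)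
    filter_upwards [h, eventually_ge_atTop (2 * (s + 2) * (s + 2))] with n hrn hn
    obtain ⟨hr, hrle⟩ := hrn
    have hm : s + 2 ≤ n / (2 * (s + 2)) := by
      rw [Nat.le_div_iff_mul_le (by omega)]; nlinarith
    obtain ⟨p, hp, hmp, hp2⟩ := Nat.exists_prime_lt_and_le_two_mul (n / (2 * (s + 2))) (by omega)
    have hpn : p * (s + 2) ≤ n := by
      have := Nat.div_mul_le_self n (2 * (s + 2))
      nlinarith
    have hnp : n < p * (2 * (s + 2)) := by
      rw [← Nat.div_lt_iff_lt_mul (by omega)]; exact hmp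
    refine le_trans ?_ (lower_bound n (r n) s p hr hp (by omega) hpn)
    have hn0 : (0 : ℝ) < n := by
      have : 0 < n := by nlinarith
      exact_mod_cast this
    have hp0 : (0 : ℝ) < p := by exact_mod_cast hp.pos
    have hnp' : (n : ℝ) ≤ p * (2 * ((s + 2 : ℕ) : ℝ)) := by exact_mod_cast hnp.le
    have hrs : (r n : ℝ) ^ s ≤ ((s + 2 : ℕ) : ℝ) ^ s * (n : ℝ) ^ 2 := by
      calc (r n : ℝ) ^ s ≤ (((s + 2 : ℕ) : ℝ) / (n : ℝ) *
            (n.choose (s + 2) : ℝ) ^ ((s : ℝ))⁻¹) ^ s :=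
            pow_le_pow_left₀ (by positivity) hrle s
        _ = (((s + 2 : ℕ) : ℝ) / (n : ℝ)) ^ s * (n.choose (s + 2) : ℝ) := by
            rw [mul_pow, hroot]
        _ ≤ (((s + 2 : ℕ) : ℝ) / (n : ℝ)) ^ s * (n : ℝ) ^ (s + 2) := by
            apply mul_le_mul_of_nonneg_left _ (by positivity)
            exact_mod_cast Nat.choose_le_pow n (s + 2)
        _ = _ := by
            rw [div_pow, pow_add]; field_simp
    apply sub_le_sub_left
    rw [div_le_div_iff₀ (by positivity) hn0]
    calc (r n : ℝ) ^ s * n ≤ (((s + 2 : ℕ) : ℝ) ^ s * (n : ℝ) ^ 2) * n :=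
          mul_le_mul_of_nonneg_right hrs hn0.le
      _ = ((s + 2 : ℕ) : ℝ) ^ s * (n : ℝ) ^ 3 := by ring
      _ ≤ ((s + 2 : ℕ) : ℝ) ^ s * (p * (2 * ((s + 2 : ℕ) : ℝ))) ^ 3 := by
          apply mul_le_mul_of_nonneg_left _ (by positivity)
          exact pow_le_pow_left₀ hn0.le hnp' 3
      _ = _ := by ring

end
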